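/- arXiv:0912.1747 — 3 statements merged into one kernel-verified Lean document; each statement's English description precedes it below -/
import Mathlib

section
/- Let 𝓗 be a complex Hilbert space, H ⊆ 𝓗 a closed subspace with inclusion map J : H → 𝓗, and let 𝓣 be a bounded linear operator on 𝓗 mapping H into H, with restriction T := 𝓣|_H. Let a ∈ ℝ, let ξ₁, …, ξ_k ∈ ℂ with Re ξᵢ > a, and let r > 0 be such that each closed ball B(ξᵢ, r) is contained in {Re z > a}; write Ω := {z ∈ ℂ : Re z > a} \ ∪_{i=1}^k B(ξᵢ, r). Assume: (H1) the spectrum of T intersected with {Re z ≥ a} is contained in {ξ₁, …, ξ_k}; (H2) there is K > 0 such that T − (a + iy) is invertible on H with ‖(T − (a+iy))⁻¹‖ ≤ K for all y ∈ ℝ; (H4) 𝓣 = 𝓐 + 𝓑 where 𝓐, 𝓑 are bounded operators on 𝓗 such that: (i) 𝓑 − ξ is invertible on 𝓗 for every ξ ∈ Ω with sup_{ξ ∈ Ω} ‖(𝓑 − ξ)⁻¹‖ =: C_B < ∞; (ii) 𝓑 maps H into H and (𝓑 − ξ)|_H is invertible on H for every ξ ∈ Ω; (iii) 𝓐 maps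 𝓗 into H, and sup_{ξ ∈ Ω} ‖𝓐 (𝓑 − ξ)⁻¹‖_{𝓛(𝓗)} =: C_{AB} < ∞. Then 𝓣 satisfies (H2) in 𝓗: for every y ∈ ℝ the operator 𝓣 − (a + iy) is invertible on 𝓗 and ‖(𝓣 − (a + iy))⁻¹‖_{𝓛(𝓗)} ≤ C_B + K · C_{AB}. -/
open MeasureTheory

/-- The region `Ω := Δ_a \ ∪ᵢ B(ξᵢ, r)`, i.e. the open half-plane `{Re z > a}`
    minus the closed balls of radius `r` around the `ξᵢ`. -/
def omegaRegion (a : ℝ) {k : ℕ} (ξ : Fin k → ℂ) (r : ℝ) : Set ℂ :=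
  {z : ℂ | a < z.re} \ ⋃ i, Metric.closedBall (ξ i) r

theorem mem_closure_omegaRegion {a : ℝ} {k : ℕ} {ξ : Fin k → ℂ} {r : ℝ}
    (hball : ∀ i, Metric.closedBall (ξ i) r ⊆ {z : ℂ | a < z.re}) {z : ℂ} (hz : z.re = a) :
    z ∈ closure (omegaRegion a ξ r) := by
  have hclosed : IsClosed (⋃ i, Metric.closedBall (ξ i) r) :=
    isClosed_iUnion_of_finite fun i => Metric.isClosed_closedBall
  have hnot : z ∈ (⋃ i, Metric.closedBall (ξ i) r)ᶜ := by
    simp only [Set.mem_compl_iff, Set.mem_iUnion, not_exists]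
    intro i hi
    exact (hball i hi).ne' hz
  have hmem : z ∈ closure {z : ℂ | a < z.re} := by
    rw [Complex.closure_setOfPred_lt_re]
    exact hz.ge
  rw [omegaRegion, Set.sdiff_eq, Set.inter_comm]
  exact hclosed.isOpen_compl.inter_closure ⟨hnot, hmem⟩

section Resolvent

variable {R : Type*} [Ring R] [Algebra ℂ R] {t : R} {z : ℂ}

theorem sub_smul_one_eq_neg : t - z • (1 : R) = -(algebraMap ℂ R z - t) := by
  rw [Algebra.algebraMap_eq_smul_one, neg_sub]

theorem isUnit_sub_smul_one_of_notMem_spectrum (h : z ∉ spectrum ℂ t) :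
    IsUnit (t - z • (1 : R)) :=
  sub_smul_one_eq_neg (t := t) (z := z) ▸ (spectrum.notMem_iff.1 h).neg

theorem inverse_sub_smul_one (h : z ∉ spectrum ℂ t) :
    Ring.inverse (t - z • (1 : R)) = -resolvent t z := by
  obtain ⟨u, hu⟩ := spectrum.notMem_iff.1 h
  rw [resolvent, sub_smul_one_eq_neg, ← hu, Ring.inverse_unit, ← Units.val_neg,
    Ring.inverse_unit, inv_neg, Units.val_neg]

end Resolvent

section UniformInverseBound

variable {R : Type*} [NormedRing R] [NormedAlgebra ℂ R] [CompleteSpace R]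
  {b : R} {S : Set ℂ} {z₀ : ℂ}

theorem isUnit_sub_smul_one_of_mem_closure {C : ℝ} (hz₀ : z₀ ∈ closure S)
    (hS : ∀ z ∈ S, IsUnit (b - z • (1 : R)))
    (hC : ∀ z ∈ S, ‖Ring.inverse (b - z • (1 : R))‖ ≤ C) :
    IsUnit (b - z₀ • (1 : R)) := by
  obtain ⟨z, hzS, hz⟩ := Metric.mem_closure_iff.1 hz₀ (1 / (|C| + 1)) (by positivity)
  rw [dist_eq_norm, lt_div_iff₀ (by positivity)] at hz
  have hnorm : ‖(z₀ - z) • Ring.inverse (b - z • (1 : R))‖ < 1 := by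
    refine (norm_smul_le _ _).trans_lt (lt_of_le_of_lt ?_ hz)
    gcongr
    linarith [hC z hzS, le_abs_self C]
  have hfactor : b - z₀ • (1 : R) =
      (b - z • (1 : R)) * (1 - (z₀ - z) • Ring.inverse (b - z • (1 : R))) := by
    rw [mul_sub, mul_smul_comm, Ring.mul_inverse_cancel _ (hS z hzS), sub_smul, mul_one]
    abel
  rw [hfactor]
  exact (hS z hzS).mul (isUnit_one_sub_of_norm_lt_one hnorm)

theorem tendsto_inverse_sub_smul_one (h : IsUnit (b - z₀ • (1 : R))) :
    Filter.Tendsto (fun z : ℂ => Ring.inverse (b - z • (1 : R))) (nhdsWithin z₀ S)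
      (nhds (Ring.inverse (b - z₀ • (1 : R)))) := by
  have hinv : ContinuousAt Ring.inverse (b - z₀ • (1 : R)) := by
    obtain ⟨u, hu⟩ := h
    exact hu ▸ NormedRing.inverse_continuousAt u
  have hsub : ContinuousAt (fun z : ℂ => b - z • (1 : R)) z₀ := by fun_prop
  exact (ContinuousAt.comp (f := fun z : ℂ => b - z • (1 : R)) hinv hsub).mono_left
    nhdsWithin_le_nhds

end UniformInverseBound

section Extension

variable {E : Type*} [NormedAddCommGroup E] [NormedSpace ℂ E] {H : Submodule ℂ E}

theorem inverse_apply_mem_of_isUnit_restrict {U : E →L[ℂ] E} {V : H →L[ℂ] H}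
    (hUV : ∀ x : H, (V x : E) = U x) (hU : IsUnit U) (hV : IsUnit V) {x : E} (hx : x ∈ H) :
    Ring.inverse U x ∈ H := by
  have hVx : V (Ring.inverse V ⟨x, hx⟩) = ⟨x, hx⟩ :=
    congrArg (fun W : H →L[ℂ] H => W ⟨x, hx⟩) (Ring.mul_inverse_cancel V hV)
  have hUx : U (Ring.inverse V ⟨x, hx⟩ : H) = x := by rw [← hUV, hVx]
  have hleft : Ring.inverse U (U (Ring.inverse V ⟨x, hx⟩ : H)) = (Ring.inverse V ⟨x, hx⟩ : H) :=
    congrArg (fun W : E →L[ℂ] E => W (Ring.inverse V ⟨x, hx⟩ : H)) (Ring.inverse_mul_cancel U hU)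
  rw [hUx] at hleft
  rw [hleft]
  exact Submodule.coe_mem _

/-- If `P + Q` restricts to an invertible operator `V` on `H`, `Q` is invertible with inverse
preserving `H`, and `P` takes values in `H`, then `P + Q` is invertible, with inverse
`Q⁻¹ - V⁻¹ P Q⁻¹`. -/
theorem isUnit_add_and_norm_inverse_le {P Q : E →L[ℂ] E} {V : H →L[ℂ] H}
    (hV : ∀ x : H, (V x : E) = (P + Q) x) (hVunit : IsUnit V) (hQ : IsUnit Q)
    (hQH : ∀ x ∈ H, Ring.inverse Q x ∈ H) (hP : ∀ x, P x ∈ H) {C K D : ℝ}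
    (hC : ‖Ring.inverse Q‖ ≤ C) (hK : ‖Ring.inverse V‖ ≤ K)
    (hD : ‖P ∘L Ring.inverse Q‖ ≤ D) :
    IsUnit (P + Q) ∧ ‖Ring.inverse (P + Q)‖ ≤ C + K * D := by
  have hQr (x : E) : Q (Ring.inverse Q x) = x :=
    congrArg (fun W : E →L[ℂ] E => W x) (Ring.mul_inverse_cancel Q hQ)
  have hQl (x : E) : Ring.inverse Q (Q x) = x :=
    congrArg (fun W : E →L[ℂ] E => W x) (Ring.inverse_mul_cancel Q hQ)
  have hVr (x : H) : V (Ring.inverse V x) = x :=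
    congrArg (fun W : H →L[ℂ] H => W x) (Ring.mul_inverse_cancel V hVunit)
  have hVl (x : H) : Ring.inverse V (V x) = x :=
    congrArg (fun W : H →L[ℂ] H => W x) (Ring.inverse_mul_cancel V hVunit)
  set G : E →L[ℂ] H := (P ∘L Ring.inverse Q).codRestrict H fun x => hP _
  have hGcoe (x : E) : (G x : E) = P (Ring.inverse Q x) := rfl
  set W : E →L[ℂ] E := Ring.inverse Q - H.subtypeL ∘L Ring.inverse V ∘L G
  have hWapp (x : E) : W x = Ring.inverse Q x - (Ring.inverse V (G x) : H) := rfl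
  have hright (x : E) : (P + Q) (W x) = x := by
    rw [hWapp, map_sub, ← hV, hVr, hGcoe, add_apply, hQr]
    abel
  have hinj (x : E) (hx : (P + Q) x = 0) : x = 0 := by
    have hQx : Q x ∈ H := by
      have : Q x = -P x := eq_neg_of_add_eq_zero_right hx
      rw [this]
      exact H.neg_mem (hP x)
    have hxH : x ∈ H := hQl x ▸ hQH _ hQx
    have hVx : V ⟨x, hxH⟩ = 0 := Subtype.ext ((hV ⟨x, hxH⟩).trans hx)
    have h0 := hVl ⟨x, hxH⟩
    rw [hVx, map_zero] at h0
    exact (congrArg Subtype.val h0).symm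
  have hleft (x : E) : W ((P + Q) x) = x :=
    sub_eq_zero.1 (hinj _ (by rw [map_sub, hright, sub_self]))
  let u : (E →L[ℂ] E)ˣ :=
    ⟨P + Q, W, ContinuousLinearMap.ext hright, ContinuousLinearMap.ext hleft⟩
  refine ⟨u.isUnit, ?_⟩
  have hinverse : Ring.inverse (P + Q) = W := Ring.inverse_unit u
  have hC0 : 0 ≤ C := (norm_nonneg _).trans hC
  have hK0 : 0 ≤ K := (norm_nonneg (Ring.inverse V)).trans hK
  have hD0 : 0 ≤ D := (norm_nonneg _).trans hD
  rw [hinverse]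
  refine ContinuousLinearMap.opNorm_le_bound _ (by positivity) fun x => ?_
  have hGx : ‖G x‖ ≤ D * ‖x‖ := (P ∘L Ring.inverse Q).le_of_opNorm_le hD x
  calc ‖W x‖ ≤ ‖Ring.inverse Q x‖ + ‖Ring.inverse V (G x)‖ := norm_sub_le _ _
    _ ≤ C * ‖x‖ + K * ‖G x‖ :=
      add_le_add (ContinuousLinearMap.le_of_opNorm_le _ hC x)
        (ContinuousLinearMap.le_of_opNorm_le _ hK _)
    _ ≤ C * ‖x‖ + K * (D * ‖x‖) := by gcongr
    _ = (C + K * D) * ‖x‖ := by ring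

end Extension

theorem statement2 {𝓗 : Type*} [NormedAddCommGroup 𝓗] [InnerProductSpace ℂ 𝓗] [CompleteSpace 𝓗]
    (H : Submodule ℂ 𝓗) (hHclosed : IsClosed (H : Set 𝓗))
    (𝓣 𝓐 𝓑 : 𝓗 →L[ℂ] 𝓗)
    -- 𝓣 maps H into H, with restriction T = 𝓣|_H
    (h𝓣H : ∀ x ∈ H, 𝓣 x ∈ H)
    (T : H →L[ℂ] H) (hT : ∀ x : H, (T x : 𝓗) = 𝓣 x)
    (a : ℝ) (k : ℕ) (ξ : Fin k → ℂ) (hξre : ∀ i, a < (ξ i).re)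
    (r : ℝ) (hr : 0 < r)
    -- the closed balls B(ξᵢ, r) are contained in the open half-plane {Re z > a}
    (hball : ∀ i, Metric.closedBall (ξ i) r ⊆ {z : ℂ | a < z.re})
    -- (H1) for T
    (hH1 : spectrum ℂ T ∩ {z : ℂ | a ≤ z.re} ⊆ Set.range ξ)
    -- (H2) for T
    (K : ℝ) (hK : 0 < K)
    (hH2 : ∀ y : ℝ, (↑a + ↑y * Complex.I) ∉ spectrum ℂ T ∧
      ‖resolvent T (↑a + ↑y * Complex.I)‖ ≤ K)
    -- (H4) decomposition 𝓣 = 𝓐 + 𝓑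
    (hsum : 𝓣 = 𝓐 + 𝓑)
    -- (i) 𝓑 − ξ is invertible on 𝓗 with uniform bound C_B on Ω
    (CB : ℝ)
    (hBinv : ∀ z ∈ omegaRegion a ξ r, IsUnit (𝓑 - z • (1 : 𝓗 →L[ℂ] 𝓗)))
    (hBbound : ∀ z ∈ omegaRegion a ξ r,
      ‖Ring.inverse (𝓑 - z • (1 : 𝓗 →L[ℂ] 𝓗))‖ ≤ CB)
    -- (ii) 𝓑 maps H into H and (𝓑 − ξ)|_H is invertible on H for ξ ∈ Ω
    (h𝓑H : ∀ x ∈ H, 𝓑 x ∈ H)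
    (B : H →L[ℂ] H) (hB : ∀ x : H, (B x : 𝓗) = 𝓑 x)
    (hBresInv : ∀ z ∈ omegaRegion a ξ r, IsUnit (B - z • (1 : H →L[ℂ] H)))
    -- (iii) 𝓐 maps 𝓗 into H with sup_{ξ ∈ Ω} ‖𝓐 (𝓑 − ξ)⁻¹‖ = C_AB < ∞
    (h𝓐H : ∀ x : 𝓗, 𝓐 x ∈ H)
    (CAB : ℝ)
    (hAB : ∀ z ∈ omegaRegion a ξ r,
      ‖𝓐 ∘L Ring.inverse (𝓑 - z • (1 : 𝓗 →L[ℂ] 𝓗))‖ ≤ CAB) :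
    -- conclusion: (H2) for 𝓣 in 𝓗
    ∀ y : ℝ, IsUnit (𝓣 - (↑a + ↑y * Complex.I) • (1 : 𝓗 →L[ℂ] 𝓗)) ∧
      ‖Ring.inverse (𝓣 - (↑a + ↑y * Complex.I) • (1 : 𝓗 →L[ℂ] 𝓗))‖ ≤ CB + K * CAB := by
  intro y
  set z₀ : ℂ := ↑a + ↑y * Complex.I with hz₀
  have hmem : z₀ ∈ closure (omegaRegion a ξ r) := mem_closure_omegaRegion hball (by simp [hz₀])
  have : (nhdsWithin z₀ (omegaRegion a ξ r)).NeBot := mem_closure_iff_nhdsWithin_neBot.1 hmem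
  have hQ : IsUnit (𝓑 - z₀ • (1 : 𝓗 →L[ℂ] 𝓗)) :=
    isUnit_sub_smul_one_of_mem_closure hmem hBinv hBbound
  have hlim := tendsto_inverse_sub_smul_one (S := omegaRegion a ξ r) hQ
  have hC : ‖Ring.inverse (𝓑 - z₀ • (1 : 𝓗 →L[ℂ] 𝓗))‖ ≤ CB :=
    le_of_tendsto hlim.norm (eventually_mem_nhdsWithin.mono hBbound)
  have hD : ‖𝓐 ∘L Ring.inverse (𝓑 - z₀ • (1 : 𝓗 →L[ℂ] 𝓗))‖ ≤ CAB :=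
    le_of_tendsto (hlim.const_mul 𝓐).norm (eventually_mem_nhdsWithin.mono hAB)
  have hQH : ∀ x ∈ H, Ring.inverse (𝓑 - z₀ • (1 : 𝓗 →L[ℂ] 𝓗)) x ∈ H := by
    intro x hx
    have hpoint : Filter.Tendsto
        (fun z : ℂ => Ring.inverse (𝓑 - z • (1 : 𝓗 →L[ℂ] 𝓗)) x)
        (nhdsWithin z₀ (omegaRegion a ξ r))
        (nhds (Ring.inverse (𝓑 - z₀ • (1 : 𝓗 →L[ℂ] 𝓗)) x)) :=
      ((ContinuousLinearMap.apply ℂ 𝓗 x).continuous.tendsto _).comp hlim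
    refine hHclosed.mem_of_tendsto hpoint ?_
    filter_upwards [eventually_mem_nhdsWithin] with z hz
    have hrestrict (w : H) : ((B - z • (1 : H →L[ℂ] H)) w : 𝓗) =
        (𝓑 - z • (1 : 𝓗 →L[ℂ] 𝓗)) w := by
      simp [hB]
    exact inverse_apply_mem_of_isUnit_restrict hrestrict (hBinv z hz) (hBresInv z hz) hx
  obtain ⟨hspec, hres⟩ := hH2 y
  have hV : IsUnit (T - z₀ • (1 : H →L[ℂ] H)) := isUnit_sub_smul_one_of_notMem_spectrum hspec
  have hK' : ‖Ring.inverse (T - z₀ • (1 : H →L[ℂ] H))‖ ≤ K := by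
    rw [inverse_sub_smul_one hspec, ContinuousLinearMap.opNorm_neg]
    exact hres
  rw [hsum, add_sub_assoc]
  exact isUnit_add_and_norm_inverse_le
    (fun x => by simp [hT, hsum, add_sub_assoc]) hV hQ hQH h𝓐H hC hK' hD
end

section
/- Let 𝓗 be a complex Banach space, H ⊆ 𝓗 a closed subspace with inclusion J : H → 𝓗, and let 𝓣, 𝓐, 𝓑 be bounded linear operators on 𝓗 with 𝓣 = 𝓐 + 𝓑. Let ξ ∈ ℂ and assume: (i) 𝓑 − ξ is invertible on 𝓗; (ii) 𝓣 maps H into H, and the restriction T − ξ := (𝓣 − ξ)|_H is invertible on H with inverse R(ξ) : H → H; (iii) 𝓐 maps 𝓗 into H. Then the bounded operator U(ξ) := (𝓑 − ξ)⁻¹ − J ∘ R(ξ) ∘ 𝓐 ∘ (𝓑 − ξ)⁻¹ on 𝓗 is a right inverse of 𝓣 − ξ, i.e. (𝓣 − ξ) ∘ U(ξ) = Id_𝓗. -/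
theorem statement4 {𝓗 : Type*} [NormedAddCommGroup 𝓗] [NormedSpace ℂ 𝓗] [CompleteSpace 𝓗]
    (H : Submodule ℂ 𝓗) (hHclosed : IsClosed (H : Set 𝓗))
    (𝓣 𝓐 𝓑 : 𝓗 →L[ℂ] 𝓗) (hsum : 𝓣 = 𝓐 + 𝓑) (ξ : ℂ)
    -- (i) 𝓑 − ξ is invertible on 𝓗
    (hB : IsUnit (𝓑 - ξ • (1 : 𝓗 →L[ℂ] 𝓗)))
    -- (ii) 𝓣 maps H into H, with restriction T = 𝓣|_H, and (T − ξ)|_H is invertible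
    -- on H with inverse R(ξ)
    (h𝓣H : ∀ x ∈ H, 𝓣 x ∈ H)
    (T : H →L[ℂ] H) (hT : ∀ x : H, (T x : 𝓗) = 𝓣 x)
    (R : H →L[ℂ] H)
    (hR1 : ∀ x : H, (T - ξ • (1 : H →L[ℂ] H)) (R x) = x)
    (hR2 : ∀ x : H, R ((T - ξ • (1 : H →L[ℂ] H)) x) = x)
    -- (iii) 𝓐 maps 𝓗 into H
    (h𝓐H : ∀ x : 𝓗, 𝓐 x ∈ H) :
    -- U(ξ) := (𝓑 − ξ)⁻¹ − J ∘ R(ξ) ∘ 𝓐 ∘ (𝓑 − ξ)⁻¹ is a right inverse of 𝓣 − ξ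
    (𝓣 - ξ • (1 : 𝓗 →L[ℂ] 𝓗)) ∘L
        (Ring.inverse (𝓑 - ξ • (1 : 𝓗 →L[ℂ] 𝓗)) -
          H.subtypeL ∘L R ∘L (𝓐.codRestrict H h𝓐H) ∘L
            Ring.inverse (𝓑 - ξ • (1 : 𝓗 →L[ℂ] 𝓗)))
      = (1 : 𝓗 →L[ℂ] 𝓗) := by
  ext x
  have hinv : (𝓑 - ξ • (1 : 𝓗 →L[ℂ] 𝓗)) (Ring.inverse (𝓑 - ξ • (1 : 𝓗 →L[ℂ] 𝓗)) x) = x :=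
    DFunLike.congr_fun (Ring.mul_inverse_cancel _ hB) x
  simp only [ContinuousLinearMap.comp_apply, sub_apply (Ring.inverse _)]
  generalize Ring.inverse (𝓑 - ξ • (1 : 𝓗 →L[ℂ] 𝓗)) x = y at hinv ⊢
  have hres := congrArg Subtype.val (hR1 (𝓐.codRestrict H h𝓐H y))
  simp only [sub_apply, smul_apply,
    one_apply_eq_self, Submodule.coe_sub, Submodule.coe_smul, hT,
    ContinuousLinearMap.coe_codRestrict_apply] at hres hinv
  simp only [map_sub, sub_apply, smul_apply,
    one_apply_eq_self, Submodule.subtypeL_apply, hres]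
  rw [hsum, add_apply, add_sub_assoc, hinv, add_sub_cancel_left]
end

section
/- Let 𝓗 be a complex Banach space, H ⊆ 𝓗 a closed subspace, and let 𝓣, 𝓐, 𝓑 be bounded linear operators on 𝓗 with 𝓣 = 𝓐 + 𝓑. Let ξ ∈ ℂ and assume: (i) 𝓑 − ξ is invertible on 𝓗; (ii) 𝓑 maps H into H and the restriction (𝓑 − ξ)|_H is invertible on H; (iii) 𝓣 maps H into H and the restriction (𝓣 − ξ)|_H is injective on H; (iv) 𝓐 maps 𝓗 into H. Then 𝓣 − ξ is injective on 𝓗. Consequently, combining with the right-inverse identity, 𝓣 − ξ is bijective on 𝓗 with inverse U(ξ) := (𝓑 − ξ)⁻¹ − J ∘ R(ξ) ∘ 𝓐 ∘ (𝓑 − ξ)⁻¹, where J : H → 𝓗 is the inclusion and R(ξ) is the inverse of (𝓣 − ξ)|_H on H. -/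
theorem statement5 {𝓗 : Type*} [NormedAddCommGroup 𝓗] [NormedSpace ℂ 𝓗] [CompleteSpace 𝓗]
    (H : Submodule ℂ 𝓗) (hHclosed : IsClosed (H : Set 𝓗))
    (𝓣 𝓐 𝓑 : 𝓗 →L[ℂ] 𝓗) (hsum : 𝓣 = 𝓐 + 𝓑) (ξ : ℂ)
    -- (i) 𝓑 − ξ is invertible on 𝓗
    (hBinv : IsUnit (𝓑 - ξ • (1 : 𝓗 →L[ℂ] 𝓗)))
    -- (ii) 𝓑 maps H into H and (𝓑 − ξ)|_H is invertible on H
    (h𝓑H : ∀ x ∈ H, 𝓑 x ∈ H)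
    (B : H →L[ℂ] H) (hB : ∀ x : H, (B x : 𝓗) = 𝓑 x)
    (hBresInv : IsUnit (B - ξ • (1 : H →L[ℂ] H)))
    -- (iii) 𝓣 maps H into H and (𝓣 − ξ)|_H is injective on H
    (h𝓣H : ∀ x ∈ H, 𝓣 x ∈ H)
    (T : H →L[ℂ] H) (hT : ∀ x : H, (T x : 𝓗) = 𝓣 x)
    (hTinj : Function.Injective ⇑(T - ξ • (1 : H →L[ℂ] H)))
    -- (iv) 𝓐 maps 𝓗 into H
    (h𝓐H : ∀ x : 𝓗, 𝓐 x ∈ H) :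
    -- 𝓣 − ξ is injective on 𝓗, and, given an inverse R(ξ) of (𝓣 − ξ)|_H on H,
    -- 𝓣 − ξ is bijective on 𝓗 with inverse U(ξ) = (𝓑 − ξ)⁻¹ − J ∘ R(ξ) ∘ 𝓐 ∘ (𝓑 − ξ)⁻¹
    Function.Injective ⇑(𝓣 - ξ • (1 : 𝓗 →L[ℂ] 𝓗)) ∧
    ∀ R : H →L[ℂ] H,
      (∀ x : H, (T - ξ • (1 : H →L[ℂ] H)) (R x) = x) →
      (∀ x : H, R ((T - ξ • (1 : H →L[ℂ] H)) x) = x) →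
      Function.Bijective ⇑(𝓣 - ξ • (1 : 𝓗 →L[ℂ] 𝓗)) ∧
      ∀ x : 𝓗,
        (𝓣 - ξ • (1 : 𝓗 →L[ℂ] 𝓗))
          ((Ring.inverse (𝓑 - ξ • (1 : 𝓗 →L[ℂ] 𝓗)) -
            H.subtypeL ∘L R ∘L (𝓐.codRestrict H h𝓐H) ∘L
              Ring.inverse (𝓑 - ξ • (1 : 𝓗 →L[ℂ] 𝓗))) x) = x ∧
        (Ring.inverse (𝓑 - ξ • (1 : 𝓗 →L[ℂ] 𝓗)) -
            H.subtypeL ∘L R ∘L (𝓐.codRestrict H h𝓐H) ∘L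
              Ring.inverse (𝓑 - ξ • (1 : 𝓗 →L[ℂ] 𝓗)))
          ((𝓣 - ξ • (1 : 𝓗 →L[ℂ] 𝓗)) x) = x := by
  have hinj : Function.Injective ⇑(𝓣 - ξ • (1 : 𝓗 →L[ℂ] 𝓗)) := by
    rw [injective_iff_map_eq_zero]
    intro x hx
    have hBx : (𝓑 - ξ • (1 : 𝓗 →L[ℂ] 𝓗)) x = -𝓐 x := by
      rw [eq_neg_iff_add_eq_zero, ← hx, hsum]
      simp only [sub_apply, add_apply]
      abel
    obtain ⟨S, hS⟩ := hBresInv.exists_right_inv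
    obtain ⟨V, hV⟩ := hBinv.exists_left_inv
    have hVB (y : 𝓗) : V ((𝓑 - ξ • (1 : 𝓗 →L[ℂ] 𝓗)) y) = y := DFunLike.congr_fun hV y
    have hBS (y : H) : (B - ξ • (1 : H →L[ℂ] H)) (S y) = y := DFunLike.congr_fun hS y
    set h : H := S ⟨-𝓐 x, H.neg_mem (h𝓐H x)⟩
    have hBh : (𝓑 - ξ • (1 : 𝓗 →L[ℂ] 𝓗)) (h : 𝓗) = -𝓐 x := by
      simpa [hB] using congrArg (Subtype.val : H → 𝓗) (hBS ⟨-𝓐 x, H.neg_mem (h𝓐H x)⟩)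
    have hxh : x = h := by rw [← hVB x, hBx, ← hBh, hVB]
    have hTh : (T - ξ • (1 : H →L[ℂ] H)) h = 0 := by
      apply Subtype.ext
      simpa [hT, hxh] using hx
    rw [hxh, (injective_iff_map_eq_zero _).mp hTinj h hTh, ZeroMemClass.coe_zero]
  refine ⟨hinj, fun R hR _ => ?_⟩
  have hright (x : 𝓗) : (𝓣 - ξ • (1 : 𝓗 →L[ℂ] 𝓗))
      ((Ring.inverse (𝓑 - ξ • (1 : 𝓗 →L[ℂ] 𝓗)) -
        H.subtypeL ∘L R ∘L (𝓐.codRestrict H h𝓐H) ∘L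
          Ring.inverse (𝓑 - ξ • (1 : 𝓗 →L[ℂ] 𝓗))) x) = x := by
    have hBy : (𝓑 - ξ • (1 : 𝓗 →L[ℂ] 𝓗)) (Ring.inverse (𝓑 - ξ • (1 : 𝓗 →L[ℂ] 𝓗)) x) = x :=
      DFunLike.congr_fun (Ring.mul_inverse_cancel _ hBinv) x
    rw [sub_apply (Ring.inverse _), map_sub]
    simp only [ContinuousLinearMap.comp_apply, Submodule.subtypeL_apply]
    generalize Ring.inverse (𝓑 - ξ • (1 : 𝓗 →L[ℂ] 𝓗)) x = y at hBy ⊢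
    have hTR : (𝓣 - ξ • (1 : 𝓗 →L[ℂ] 𝓗)) (R (𝓐.codRestrict H h𝓐H y) : 𝓗) = 𝓐 y := by
      simpa [hT] using congrArg (Subtype.val : H → 𝓗) (hR (𝓐.codRestrict H h𝓐H y))
    rw [hTR, ← hBy, hsum]
    simp only [sub_apply, add_apply]
    abel
  exact ⟨⟨hinj, fun x => ⟨_, hright x⟩⟩, fun x => ⟨hright x, hinj (hright _)⟩⟩
end
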